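/- arXiv:2011.01524 — 2 statements merged into one kernel-verified Lean document; each statement's English description precedes it below -/
import Mathlib

section
/- Let G be a finitely generated abelian monoid (hence countable), R a ring, and A an Artinian R-module. Let Σ ⊆ A^G be a subshift that is closed in the prodiscrete topology and is an R-submodule of A^G. Then the right shift action of G on Σ, given by T(g, x) := g ⋆ x, has the shadowing property. -/
/-- The right shift action: `(g ⋆ x)(h) = x (h * g)`. -/
def shiftMul {G A : Type*} [Mul G] (g : G) (x : G → A) : G → A := fun h => x (h * g)

/-- An exhaustion of a countable monoid: `E 0 = ∅`, increasing, covering `G`,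
with each `E n` finite. -/
def IsExhaustion {G : Type*} (E : ℕ → Finset G) : Prop :=
  E 0 = ∅ ∧ (∀ n, E n ⊆ E (n + 1)) ∧ ∀ g : G, ∃ n, g ∈ E n

open Classical in
/-- The standard Hamming metric associated with the exhaustion `E`:
`d(x,y) = 2^{-n}` with `n = sup {k | x = y on E k}`, and `0` if `x = y`. -/
noncomputable def hamming {G A : Type*} (E : ℕ → Finset G) (x y : G → A) : ℝ :=
  if x = y then 0 else (2 : ℝ)⁻¹ ^ sSup {k : ℕ | ∀ g ∈ E k, x g = y g}

/-- `(S, d, δ)`-pseudo-orbit of the action `T` of `Γ` on `X`. -/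
def IsPseudoOrbit {Γ X : Type*} [Monoid Γ] (T : Γ → X → X) (S : Set Γ)
    (d : X → X → ℝ) (δ : ℝ) (o : Γ → X) : Prop :=
  ∀ σ ∈ S, ∀ t : Γ, d (T σ (o t)) (o (σ * t)) < δ

/-- The `(S, d)`-shadowing property of the action `T` of `Γ` on `X`. -/
def HasShadowing {Γ X : Type*} [Monoid Γ] (T : Γ → X → X) (S : Set Γ)
    (d : X → X → ℝ) : Prop :=
  ∀ ε > (0 : ℝ), ∃ δ > (0 : ℝ), ∀ o : Γ → X, IsPseudoOrbit T S d δ o →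
    ∃ x : X, ∀ t : Γ, d (T t x) (o t) < ε

/-- The intrinsic shadowing property for an action of a finitely generated monoid `Γ`
on a subshift `X ⊆ A^G` (given via the inclusion `ι : X → (G → A)`): the
`(S, d|_X)`-shadowing property holds for every finite generating set `S` of `Γ`
and every standard Hamming metric `d` on `A^G`. -/
def HasShadowingProperty {Γ G A X : Type*} [Monoid Γ] [Monoid G]
    (ι : X → (G → A)) (T : Γ → X → X) : Prop :=
  ∀ S : Set Γ, S.Finite → Submonoid.closure S = ⊤ →
    ∀ E : ℕ → Finset G, IsExhaustion E →
      HasShadowing T S fun x y => hamming E (ι x) (ι y)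

theorem eqOn_of_hamming_lt {G A : Type*} {E : ℕ → Finset G} (hE : IsExhaustion E)
    {x y : G → A} {N : ℕ} (h : hamming E x y < (2 : ℝ)⁻¹ ^ N) : ∀ g ∈ E N, x g = y g := by
  by_cases hxy : x = y
  · simp [hxy]
  rw [hamming, if_neg hxy, pow_lt_pow_iff_right_of_lt_one₀ (by norm_num) (by norm_num)] at h
  obtain ⟨k, hk, hNk⟩ := exists_lt_of_lt_csSup ⟨0, by simp [hE.1]⟩ h
  exact fun g hg => hk g (monotone_nat_of_le_succ hE.2.1 hNk.le hg)

theorem hamming_le_of_eqOn {G A : Type*} {E : ℕ → Finset G} (hE : IsExhaustion E)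
    {x y : G → A} {N : ℕ} (h : ∀ g ∈ E N, x g = y g) : hamming E x y ≤ (2 : ℝ)⁻¹ ^ N := by
  by_cases hxy : x = y
  · simp [hamming, hxy]
  rw [hamming, if_neg hxy]
  refine pow_le_pow_of_le_one (by norm_num) (by norm_num) (le_csSup ?_ h)
  obtain ⟨g, hg⟩ := Function.ne_iff.1 hxy
  obtain ⟨K, hK⟩ := hE.2.2 g
  refine ⟨K, fun k hk => le_of_not_gt fun hKk => hg (hk g ?_)⟩
  exact monotone_nat_of_le_succ hE.2.1 hKk.le hK

theorem IsExhaustion.exists_subset {G : Type*} {E : ℕ → Finset G} (hE : IsExhaustion E)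
    (K : Finset G) : ∃ N, K ⊆ E N := by
  classical
  induction K using Finset.induction_on with
  | empty => exact ⟨0, by simp⟩
  | insert a s _ ih =>
    obtain ⟨N, hN⟩ := ih
    obtain ⟨M, hM⟩ := hE.2.2 a
    have hmono := monotone_nat_of_le_succ hE.2.1
    exact ⟨max N M, Finset.insert_subset (hmono (le_max_right N M) hM)
      (hN.trans (hmono (le_max_left N M)))⟩

/-- An antitone map from a well-quasi-order to a well-founded order has, up to equality of
values, only finitely many minimal arguments. -/
theorem Antitone.exists_finset_forall_exists_le_eq {P β : Type*} [PartialOrder P]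
    [WellQuasiOrderedLE P] [PartialOrder β] [WellFoundedLT β] {L : P → β} (hL : Antitone L) :
    ∃ F : Finset P, ∀ m, ∃ f ∈ F, f ≤ m ∧ L f = L m := by
  have hfin : {m : P | ∀ f < m, L f ≠ L m}.Finite := by
    by_contra hinf
    let e := Set.Infinite.natEmbedding _ hinf
    obtain ⟨g, hg⟩ := (wellQuasiOrdered_le (α := P)).exists_monotone_subseq fun n => (e n : P)
    have hanti : Antitone fun n => L (e (g n)) := fun m n hmn => hL (hg m n hmn)
    obtain ⟨n, hn⟩ := WellFoundedGT.monotone_chain_condition (α := βᵒᵈ)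
      ⟨fun n => OrderDual.toDual (L (e (g n))), hanti.dual_right⟩
    have hne : (e (g n) : P) ≠ e (g (n + 1)) := fun h => by
      simpa using g.injective (e.injective (Subtype.ext h))
    exact (e (g (n + 1))).2 _ (lt_of_le_of_ne (hg _ _ n.le_succ) hne) (hn (n + 1) n.le_succ)
  refine ⟨hfin.toFinset, fun m => ?_⟩
  obtain ⟨f, ⟨hfm, hf⟩, hmin⟩ :=
    (wellFounded_lt (α := P)).has_min {f | f ≤ m ∧ L f = L m} ⟨m, le_rfl, rfl⟩
  refine ⟨f, ?_, hfm, hf⟩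
  simp only [Set.Finite.mem_toFinset, Set.mem_ofPred_eq]
  exact fun f' hlt heq => hmin f' ⟨hlt.le.trans hfm, heq.trans hf⟩ hlt

theorem Finsupp.DegLex.finite_Iic {σ : Type*} [Finite σ] [LinearOrder σ]
    (m : DegLex (σ →₀ ℕ)) : (Set.Iic m).Finite := by
  have h := Finsupp.finite_of_degree_le (σ := σ) (ofDegLex m).degree
  exact (h.preimage ofDegLex_injective.injOn).subset fun a ha => monotone_degree ha

/-- The values at `φ m` of those configurations in `X` that vanish at `φ i` for all `i < m` in
the degree-lexicographic order. -/
def leadingValues {G R A σ : Type*} [LinearOrder σ] [Ring R] [AddCommGroup A] [Module R A]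
    (X : Submodule R (G → A)) (φ : (σ →₀ ℕ) → G) (m : σ →₀ ℕ) : Submodule R A :=
  (X ⊓ ⨅ i : {i : σ →₀ ℕ // toDegLex i < toDegLex m},
    LinearMap.ker (LinearMap.proj (φ i) : (G → A) →ₗ[R] A)).map (LinearMap.proj (φ m))

theorem mem_leadingValues {G R A σ : Type*} [LinearOrder σ] [Ring R] [AddCommGroup A]
    [Module R A] {X : Submodule R (G → A)} {φ : (σ →₀ ℕ) → G} {m : σ →₀ ℕ} {a : A} :
    a ∈ leadingValues X φ m ↔
      ∃ x ∈ X, (∀ i, toDegLex i < toDegLex m → x (φ i) = 0) ∧ x (φ m) = a := by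
  simp [leadingValues, and_assoc]

theorem leadingValues_antitone {G R A σ : Type*} [Mul G] [LinearOrder σ] [Ring R]
    [AddCommGroup A] [Module R A] {X : Submodule R (G → A)}
    (hX : ∀ g : G, ∀ x ∈ X, shiftMul g x ∈ X) {φ : (σ →₀ ℕ) → G}
    (hφ : ∀ a b, φ (a + b) = φ a * φ b) : Antitone (leadingValues X φ) := by
  intro m n hmn a ha
  obtain ⟨k, rfl⟩ := exists_add_of_le hmn
  obtain ⟨x, hx, h0, rfl⟩ := mem_leadingValues.1 ha
  refine mem_leadingValues.2 ⟨_, hX (φ k) x hx, fun i hi => ?_, by simp [shiftMul, hφ]⟩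
  rw [shiftMul, ← hφ]
  exact h0 _ (by rw [toDegLex_add, toDegLex_add]; exact add_lt_add_left hi _)

/-- A closed shift-invariant submodule of `A^G` is a subshift of finite type. -/
theorem exists_finset_forall_shiftMul_imp_mem {G R A σ : Type*} [Mul G] [Finite σ]
    [LinearOrder σ] [Ring R] [AddCommGroup A] [Module R A] [IsArtinian R A]
    [TopologicalSpace A] [DiscreteTopology A] {X : Submodule R (G → A)}
    (hX : ∀ g : G, ∀ x ∈ X, shiftMul g x ∈ X) (hclosed : IsClosed (X : Set (G → A)))
    {φ : (σ →₀ ℕ) → G} (hφ : ∀ a b, φ (a + b) = φ a * φ b) (hsurj : Function.Surjective φ) :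
    ∃ D : Finset G, ∀ x : G → A,
      (∀ g, ∃ y ∈ X, ∀ h ∈ D, shiftMul g x h = y h) → x ∈ X := by
  classical
  obtain ⟨F, hF⟩ := (leadingValues_antitone hX hφ).exists_finset_forall_exists_le_eq
  let D : Finset G := F.biUnion fun f =>
    (Finsupp.DegLex.finite_Iic (toDegLex f)).toFinset.image fun i => φ (ofDegLex i)
  have hD : ∀ f ∈ F, ∀ i, toDegLex i ≤ toDegLex f → φ i ∈ D := fun f hf i hi =>
    Finset.mem_biUnion.2 ⟨f, hf, Finset.mem_image.2 ⟨toDegLex i, by simpa using hi, rfl⟩⟩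
  refine ⟨D, fun x hx => ?_⟩
  have key : ∀ u : G → A, (∀ g, ∃ y ∈ X, ∀ h ∈ D, shiftMul g u h = y h) → ∀ m : σ →₀ ℕ,
      (∀ i, toDegLex i < toDegLex m → u (φ i) = 0) → u (φ m) ∈ leadingValues X φ m := by
    intro u hu m h0
    obtain ⟨f, hf, hfm, hL⟩ := hF m
    obtain ⟨k, rfl⟩ := exists_add_of_le hfm
    obtain ⟨y, hy, hyD⟩ := hu (φ k)
    rw [← hL]
    refine mem_leadingValues.2 ⟨y, hy, fun i hi => ?_, ?_⟩
    · rw [← hyD _ (hD f hf i hi.le), shiftMul, ← hφ]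
      exact h0 _ (by rw [toDegLex_add, toDegLex_add]; exact add_lt_add_left hi _)
    · rw [← hyD _ (hD f hf f le_rfl), shiftMul, ← hφ]
  have approx : ∀ s : Finset (DegLex (σ →₀ ℕ)), IsLowerSet (s : Set (DegLex (σ →₀ ℕ))) →
      ∃ y ∈ X, ∀ i ∈ s, x (φ (ofDegLex i)) = y (φ (ofDegLex i)) := by
    intro s
    induction s using Finset.induction_on_max with
    | empty => exact fun _ => ⟨0, X.zero_mem, by simp⟩
    | insert a s ha ih =>
      intro hs
      have mem_of_lt : ∀ i < a, i ∈ s := fun i hi =>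
        Finset.mem_of_mem_insert_of_ne (hs hi.le (Finset.mem_insert_self a s)) hi.ne
      obtain ⟨y, hy, hxy⟩ := ih fun b c hcb hb => mem_of_lt c (hcb.trans_lt (ha b hb))
      have hu : ∀ g, ∃ z ∈ X, ∀ h ∈ D, shiftMul g (x - y) h = z h := fun g => by
        obtain ⟨z, hz, hzD⟩ := hx g
        refine ⟨z - shiftMul g y, X.sub_mem hz (hX g y hy), fun h hh => ?_⟩
        rw [Pi.sub_apply, ← hzD h hh]
        rfl
      obtain ⟨w, hw, hw0, hwa⟩ := mem_leadingValues.1 <| key (x - y) hu (ofDegLex a) fun i hi =>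
        sub_eq_zero.2 (hxy (toDegLex i) (mem_of_lt _ hi))
      refine ⟨y + w, X.add_mem hy hw, fun i hi => ?_⟩
      rcases Finset.mem_insert.1 hi with rfl | hi
      · simp [hwa]
      · rw [Pi.add_apply, hw0 (ofDegLex i) (ha i hi), add_zero, hxy i hi]
  rw [← SetLike.mem_coe, ← hclosed.closure_eq, mem_closure_iff]
  intro U hU hxU
  obtain ⟨I, u, hIu, hIU⟩ := isOpen_pi_iff.1 hU x hxU
  choose ψ hψ using hsurj
  let s : Finset (DegLex (σ →₀ ℕ)) :=
    I.biUnion fun g => (Finsupp.DegLex.finite_Iic (toDegLex (ψ g))).toFinset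
  have hs : IsLowerSet (s : Set (DegLex (σ →₀ ℕ))) := by
    intro b c hcb hb
    simp only [s, Finset.coe_biUnion, Set.mem_iUnion, Set.Finite.coe_toFinset] at hb ⊢
    obtain ⟨g, hg, hbg⟩ := hb
    exact ⟨g, hg, hcb.trans hbg⟩
  obtain ⟨y, hy, hxy⟩ := approx s hs
  refine ⟨y, hIU fun g hg => ?_, hy⟩
  have hgs := hxy (toDegLex (ψ g))
    (Finset.mem_biUnion.2 ⟨g, hg, by simp⟩)
  rw [ofDegLex_toDegLex, hψ] at hgs
  exact hgs ▸ (hIu g hg).2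

theorem exists_finsupp_surjective_map_add {G : Type*} [CommMonoid G] {S : Finset G}
    (hS : Submonoid.closure (S : Set G) = ⊤) :
    ∃ φ : (Fin S.card →₀ ℕ) → G,
      (∀ a b, φ (a + b) = φ a * φ b) ∧ Function.Surjective φ := by
  let φ : (Fin S.card →₀ ℕ) → G := fun a => ∏ i, (S.equivFin.symm i : G) ^ a i
  have hφ : ∀ a b, φ (a + b) = φ a * φ b := fun a b => by
    simp [φ, pow_add, Finset.prod_mul_distrib]
  refine ⟨φ, hφ, fun g => ?_⟩
  have hg : g ∈ Submonoid.closure (S : Set G) := hS ▸ Submonoid.mem_top g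
  induction hg using Submonoid.closure_induction with
  | mem x hx =>
    refine ⟨Finsupp.single (S.equivFin ⟨x, hx⟩) 1, ?_⟩
    simp only [φ]
    rw [Finset.prod_eq_single (S.equivFin ⟨x, hx⟩)]
    · simp
    · intro i _ hi
      simp [Finsupp.single_eq_of_ne hi]
    · simp
  | one => exact ⟨0, by simp [φ]⟩
  | mul x y _ _ ihx ihy =>
    obtain ⟨a, rfl⟩ := ihx
    obtain ⟨b, rfl⟩ := ihy
    exact ⟨a + b, hφ a b⟩

theorem exists_finset_forall_apply_eq_apply_one {G : Type*} (A : Type*) [Monoid G] {S : Set G}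
    (hS : Submonoid.closure S = ⊤) (g : G) :
    ∃ W : Finset G, ∀ o : G → G → A, (∀ s ∈ S, ∀ t, ∀ h ∈ W, o t (h * s) = o (s * t) h) →
      ∀ t, o t g = o (g * t) 1 := by
  classical
  have hg : g ∈ Submonoid.closure S := hS ▸ Submonoid.mem_top g
  induction hg using Submonoid.closure_induction_right with
  | one => exact ⟨∅, by simp⟩
  | mul_right x _ s hs ih =>
    obtain ⟨W, hW⟩ := ih
    refine ⟨insert x W, fun o ho t => ?_⟩
    rw [ho s hs t x (Finset.mem_insert_self x W), mul_assoc,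
      hW o fun s hs t h hh => ho s hs t h (Finset.mem_insert_of_mem hh)]

theorem statement17 {G : Type*} [CommMonoid G] [Countable G]
    (hfg : ∃ S : Finset G, Submonoid.closure (S : Set G) = ⊤)
    {R : Type*} [Ring R] {A : Type*} [AddCommGroup A] [Module R A] [IsArtinian R A]
    [TopologicalSpace A] [DiscreteTopology A]
    (Sgm : Submodule R (G → A))
    (hshift : ∀ g : G, ∀ x ∈ Sgm, shiftMul g x ∈ Sgm)
    (hclosed : IsClosed (Sgm : Set (G → A))) :
    HasShadowingProperty (fun x : ↥Sgm => x.1)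
      (fun (g : G) (x : ↥Sgm) => (⟨shiftMul g x.1, hshift g x.1 x.2⟩ : ↥Sgm)) := by
  classical
  obtain ⟨S₀, hS₀⟩ := hfg
  obtain ⟨φ, hφ, hsurj⟩ := exists_finsupp_surjective_map_add hS₀
  obtain ⟨D, hD⟩ := exists_finset_forall_shiftMul_imp_mem hshift hclosed hφ hsurj
  intro S _ hS E hE ε hε
  obtain ⟨n, hn⟩ := exists_pow_lt_of_lt_one hε (show (2 : ℝ)⁻¹ < 1 by norm_num)
  choose W hW using exists_finset_forall_apply_eq_apply_one (G := G) A hS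
  obtain ⟨N, hN⟩ := hE.exists_subset ((E n ∪ D).biUnion W)
  refine ⟨(2 : ℝ)⁻¹ ^ N, by positivity, fun o ho => ?_⟩
  have hval : ∀ t, ∀ g ∈ E n ∪ D, (o t).1 g = (o (g * t)).1 1 := fun t g hg =>
    hW g (fun t => (o t).1) (fun s hs t h hh => eqOn_of_hamming_lt hE (ho s hs t) h
      (hN (Finset.mem_biUnion.2 ⟨g, hg, hh⟩))) t
  have hx : (fun t => (o t).1 1) ∈ Sgm := hD _ fun t =>
    ⟨(o t).1, (o t).2, fun h hh => (hval t h (Finset.mem_union_right _ hh)).symm⟩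
  exact ⟨⟨_, hx⟩, fun t => (hamming_le_of_eqOn hE fun g hg =>
    (hval t g (Finset.mem_union_left _ hg)).symm).trans_lt hn⟩
end

section
/- Let A be a group with at least two elements and identity element 1_A, and let G := ⊕_{i∈ℕ} ℤ/2ℤ be the direct sum of countably many copies of ℤ/2ℤ. Let Σ := {a^G : a ∈ A} ⊆ A^G be the subshift of constant configurations, where a^G(g) := a for all g ∈ G. For n ≥ 1 let E_n := {g = (g_i)_{i∈ℕ} ∈ G : g_i = 0 for all i ≥ n}, let E_0 := ∅, and let d be the standard Hamming metric on A^G associated with the exhaustion (E_n)_{n≥0}. Then for every integer m ≥ 1, the right shift action T(g, x) := g ⋆ x of G on Σ fails the (E_m, d|_Σ)-shadowing property; more precisely, taking ε = 1/2, for every δ > 0 there exists a family (x_g)_{g∈G} in Σ with d(σ ⋆ x_g, x_{σ+g}) < δ for all σ ∈ E_m and g ∈ G, yet there is no x ∈ Σ with d(g ⋆ x, x_g) < ε for all g ∈ G. -/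
/-- The right shift action for an additive monoid: `(g ⋆ x)(h) = x (h + g)`. -/
def shiftAdd {G A : Type*} [Add G] (g : G) (x : G → A) : G → A := fun h => x (h + g)

/-- `(S, d, δ)`-pseudo-orbit for an action of an additive monoid. -/
def IsPseudoOrbitAdd {Γ X : Type*} [AddMonoid Γ] (T : Γ → X → X) (S : Set Γ)
    (d : X → X → ℝ) (δ : ℝ) (o : Γ → X) : Prop :=
  ∀ σ ∈ S, ∀ t : Γ, d (T σ (o t)) (o (σ + t)) < δ

/-- The `(S, d)`-shadowing property for an action of an additive monoid. -/
def HasShadowingAdd {Γ X : Type*} [AddMonoid Γ] (T : Γ → X → X) (S : Set Γ)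
    (d : X → X → ℝ) : Prop :=
  ∀ ε > (0 : ℝ), ∃ δ > (0 : ℝ), ∀ o : Γ → X, IsPseudoOrbitAdd T S d δ o →
    ∃ x : X, ∀ t : Γ, d (T t x) (o t) < ε

theorem hamming_self {G A : Type*} (E : ℕ → Finset G) (x : G → A) : hamming E x x = 0 := by
  simp [hamming]

theorem shiftAdd_const {G A : Type*} [Add G] (g : G) (a : A) :
    shiftAdd g (Function.const G a) = Function.const G a := rfl

theorem hamming_const_of_ne {G A : Type*} {E : ℕ → Finset G} (h0 : E 0 = ∅)
    (hE : ∀ n, 1 ≤ n → (E n).Nonempty) {a b : A} (hab : a ≠ b) :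
    hamming E (Function.const G a) (Function.const G b) = 1 := by
  obtain ⟨g, -⟩ := hE 1 le_rfl
  have hne : Function.const G a ≠ Function.const G b := fun h => hab (congrFun h g)
  have hset : {k : ℕ | ∀ g ∈ E k, Function.const G a g = Function.const G b g} = {0} := by
    ext k
    simp only [Function.const_apply, Set.mem_ofPred_eq, Set.mem_singleton_iff]
    constructor
    · intro h
      by_contra hk
      obtain ⟨g, hg⟩ := hE k (Nat.one_le_iff_ne_zero.mpr hk)
      exact hab (h g hg)
    · rintro rfl
      simp [h0]
  rw [hamming, if_neg hne, hset, csSup_singleton, pow_zero]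

theorem statement19 {A : Type*} [Group A] [Nontrivial A]
    (E : ℕ → Finset (ℕ →₀ ZMod 2))
    (hE : ∀ (n : ℕ) (g : ℕ →₀ ZMod 2), g ∈ E n ↔ (1 ≤ n ∧ ∀ i, n ≤ i → g i = 0))
    (Sgm : Set ((ℕ →₀ ZMod 2) → A))
    (hSgm : Sgm = Set.range fun a : A => Function.const (ℕ →₀ ZMod 2) a)
    (hinv : ∀ g : ℕ →₀ ZMod 2, ∀ x ∈ Sgm, shiftAdd g x ∈ Sgm)
    (m : ℕ) (hm : 1 ≤ m) :
    ¬ HasShadowingAdd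
        (fun (g : ℕ →₀ ZMod 2) (x : ↥Sgm) => (⟨shiftAdd g x.1, hinv g x.1 x.2⟩ : ↥Sgm))
        ((E m : Finset (ℕ →₀ ZMod 2)) : Set (ℕ →₀ ZMod 2))
        (fun x y => hamming E x.1 y.1) ∧
    ∀ δ > (0 : ℝ), ∃ o : (ℕ →₀ ZMod 2) → ↥Sgm,
      (∀ σ ∈ E m, ∀ g : ℕ →₀ ZMod 2,
        hamming E (shiftAdd σ (o g).1) (o (σ + g)).1 < δ) ∧
      ¬ ∃ x : ↥Sgm, ∀ g : ℕ →₀ ZMod 2, hamming E (shiftAdd g x.1) (o g).1 < 1 / 2 := by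
  have h0 : E 0 = ∅ := by
    ext g
    simp [hE]
  have hne : ∀ n, 1 ≤ n → (E n).Nonempty := fun n hn => ⟨0, (hE n 0).mpr ⟨hn, by simp⟩⟩
  have key : ∀ δ > (0 : ℝ), ∃ o : (ℕ →₀ ZMod 2) → ↥Sgm,
      (∀ σ ∈ E m, ∀ g : ℕ →₀ ZMod 2,
        hamming E (shiftAdd σ (o g).1) (o (σ + g)).1 < δ) ∧
      ¬ ∃ x : ↥Sgm, ∀ g : ℕ →₀ ZMod 2, hamming E (shiftAdd g x.1) (o g).1 < 1 / 2 := by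
    subst hSgm
    intro δ hδ
    obtain ⟨a, b, hab⟩ := exists_pair_ne A
    refine ⟨fun g => ⟨Function.const _ (if g m = 0 then a else b), _, rfl⟩, ?_, ?_⟩
    · intro σ hσ g
      have hσm : σ m = 0 := ((hE m σ).mp hσ).2 m le_rfl
      simp only [shiftAdd_const, Finsupp.add_apply, hσm, zero_add, hamming_self]
      exact hδ
    · rintro ⟨⟨_, c, rfl⟩, hx⟩
      have hc : ∀ g : ℕ →₀ ZMod 2, c = if g m = 0 then a else b := by
        intro g
        by_contra hcg
        have h := hx g
        simp only [shiftAdd_const] at h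
        rw [hamming_const_of_ne h0 hne hcg] at h
        norm_num at h
      have ha : c = a := by simpa using hc 0
      have hb : c = b := by simpa using hc (Finsupp.single m 1)
      exact hab (ha.symm.trans hb)
  refine ⟨fun h => ?_, key⟩
  obtain ⟨δ, hδ, hs⟩ := h (1 / 2) (by norm_num)
  obtain ⟨o, ho, hno⟩ := key δ hδ
  exact hno (hs o ho)
end
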